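/- arXiv:1907.08935 — 2 statements merged into one kernel-verified Lean document; each statement's English description precedes it below -/
import Mathlib

section
/- Let (X, M, *) be a stationary fuzzy metric space. Then for every y ∈ X, the real-valued function M_y : X → (0,1] defined by M_y(x) = M(x, y) is ℝ-uniformly continuous; that is, for every ε > 0 there exists δ ∈ (0, 1) such that for all x, z ∈ X, M(x, z) > 1 - δ implies |M(x, y) - M(z, y)| < ε. -/
/-- A function continuous on the unit square with `star a 1 = a` stays uniformly close to its
first argument when its second argument is near `1`. -/
theorem exists_forall_sub_lt_star_of_continuousOn {star : ℝ → ℝ → ℝ}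
    (hcont : ContinuousOn (fun p : ℝ × ℝ => star p.1 p.2)
      (Set.Icc (0:ℝ) 1 ×ˢ Set.Icc (0:ℝ) 1))
    (hone : ∀ a : ℝ, a ∈ Set.Icc (0:ℝ) 1 → star a 1 = a) {ε : ℝ} (hε : 0 < ε) :
    ∃ δ ∈ Set.Ioo (0:ℝ) 1, ∀ a ∈ Set.Icc (0:ℝ) 1, ∀ t ∈ Set.Icc (0:ℝ) 1,
      1 - δ < t → a - ε < star a t := by
  have huc := (isCompact_Icc.prod isCompact_Icc).uniformContinuousOn_of_continuous hcont
  obtain ⟨η, hη, h⟩ := Metric.uniformContinuousOn_iff.1 huc ε hε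
  refine ⟨min η (1 / 2), ⟨by positivity, (min_le_right _ _).trans_lt (by norm_num)⟩, ?_⟩
  intro a ha t ht hlt
  have hdist : dist (a, t) (a, (1:ℝ)) < η := by
    rw [Prod.dist_eq, dist_self, Real.dist_eq, max_lt_iff, abs_lt]
    have := min_le_left η (1 / 2)
    exact ⟨hη, by linarith, by linarith [ht.2]⟩
  have hstar := h (a, t) ⟨ha, ht⟩ (a, 1) ⟨ha, zero_le_one, le_rfl⟩ hdist
  simp only [hone a ha, Real.dist_eq, abs_lt] at hstar
  linarith [hstar.1]

/-- In a stationary fuzzy metric space `(X, M, *)`, for every `y ∈ X`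
the function `x ↦ M(x, y)` is ℝ-uniformly continuous. -/
theorem stationary_fuzzy_metric_My_R_uniformly_continuous
    {X : Type*} [Nonempty X]
    (star : ℝ → ℝ → ℝ) (M : X → X → ℝ)
    -- `star` is a continuous t-norm on [0,1]:
    (hstar_mem : ∀ a b : ℝ, a ∈ Set.Icc (0:ℝ) 1 → b ∈ Set.Icc (0:ℝ) 1 →
      star a b ∈ Set.Icc (0:ℝ) 1)
    (hstar_cont : ContinuousOn (fun p : ℝ × ℝ => star p.1 p.2)
      (Set.Icc (0:ℝ) 1 ×ˢ Set.Icc (0:ℝ) 1))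
    (hstar_comm : ∀ a b : ℝ, a ∈ Set.Icc (0:ℝ) 1 → b ∈ Set.Icc (0:ℝ) 1 →
      star a b = star b a)
    (hstar_assoc : ∀ a b c : ℝ, a ∈ Set.Icc (0:ℝ) 1 → b ∈ Set.Icc (0:ℝ) 1 →
      c ∈ Set.Icc (0:ℝ) 1 → star (star a b) c = star a (star b c))
    (hstar_mono : ∀ a b c : ℝ, a ∈ Set.Icc (0:ℝ) 1 → b ∈ Set.Icc (0:ℝ) 1 →
      c ∈ Set.Icc (0:ℝ) 1 → a ≤ b → star a c ≤ star b c)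
    (hstar_one : ∀ a : ℝ, a ∈ Set.Icc (0:ℝ) 1 → star a 1 = a)
    -- `M` is a stationary fuzzy metric:
    (hM_mem : ∀ x y : X, M x y ∈ Set.Ioc (0:ℝ) 1)
    (hM_eq_one : ∀ x y : X, M x y = 1 ↔ x = y)
    (hM_symm : ∀ x y : X, M x y = M y x)
    (hM_tri : ∀ x y z : X, star (M x y) (M y z) ≤ M x z)
    (y : X) :
    ∀ ε : ℝ, ε > 0 → ∃ δ ∈ Set.Ioo (0:ℝ) 1,
      ∀ x z : X, M x z > 1 - δ → |M x y - M z y| < ε := by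
  intro ε hε
  obtain ⟨δ, hδ, h⟩ := exists_forall_sub_lt_star_of_continuousOn hstar_cont hstar_one hε
  have hM : ∀ x z, M x z ∈ Set.Icc (0:ℝ) 1 := fun x z => Set.Ioc_subset_Icc_self (hM_mem x z)
  have key : ∀ x z, M x z > 1 - δ → M x y - ε < M z y := fun x z hxz => by
    have htri := hM_tri z x y
    rw [hstar_comm _ _ (hM z x) (hM x y), hM_symm z x] at htri
    exact (h _ (hM x y) _ (hM x z) hxz).trans_le htri
  refine ⟨δ, hδ, fun x z hxz => abs_lt.2 ⟨?_, ?_⟩⟩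
  · linarith [key z x (hM_symm x z ▸ hxz)]
  · linarith [key x z hxz]
end

section
/- Let (X, M, *) be a stationary fuzzy metric space and define M̂ : X² × X² → (0,1] by M̂((x₁, x₂), (y₁, y₂)) = min{M(x₁, y₁), M(x₂, y₂)}. Then the function M : X² → (0,1], (x, y) ↦ M(x, y), is ℝ-uniformly continuous with respect to M̂; that is, for every ε > 0 there exists δ ∈ (0, 1) such that for all (x, z), (x', z') ∈ X², if M̂((x, z), (x', z')) > 1 - δ then |M(x, z) - M(x', z')| < ε. -/
/-- A continuous binary operation on `[0,1]` with right unit `1` satisfies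
`a - ε < star a b` uniformly in `a` for `b` close to `1`. -/
theorem exists_forall_sub_lt_of_continuousOn_of_right_one
    (star : ℝ → ℝ → ℝ)
    (hcont : ContinuousOn (fun p : ℝ × ℝ => star p.1 p.2)
      (Set.Icc (0:ℝ) 1 ×ˢ Set.Icc (0:ℝ) 1))
    (hone : ∀ a : ℝ, a ∈ Set.Icc (0:ℝ) 1 → star a 1 = a)
    {ε : ℝ} (hε : 0 < ε) :
    ∃ δ ∈ Set.Ioo (0:ℝ) 1, ∀ a ∈ Set.Icc (0:ℝ) 1, ∀ b ∈ Set.Icc (0:ℝ) 1,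
      1 - δ < b → a - ε < star a b := by
  have huc := (isCompact_Icc.prod isCompact_Icc).uniformContinuousOn_of_continuous hcont
  obtain ⟨δ, hδ, h⟩ := Metric.uniformContinuousOn_iff.1 huc ε hε
  refine ⟨min δ (1 / 2), ⟨by positivity, by
    linarith [min_le_right δ (1 / 2)]⟩, fun a ha b hb hab => ?_⟩
  have hdist : dist (a, b) (a, (1 : ℝ)) < δ := by
    rw [Prod.dist_eq, dist_self, Real.dist_eq]
    refine max_lt hδ (abs_lt.2 ⟨?_, ?_⟩) <;> linarith [min_le_left δ (1 / 2), hb.2]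
  have hlt := h (a, b) ⟨ha, hb⟩ (a, 1) ⟨ha, by simp⟩ hdist
  rw [Real.dist_eq] at hlt
  simp only [hone a ha] at hlt
  linarith [(abs_lt.1 hlt).1]

/-- In a stationary fuzzy metric space `(X, M, *)`, the function
`(x, y) ↦ M(x, y)` is ℝ-uniformly continuous with respect to the fuzzy metric
`M̂((x₁,x₂),(y₁,y₂)) = min (M x₁ y₁) (M x₂ y₂)` on `X²`. -/
theorem stationary_fuzzy_metric_M_R_uniformly_continuous_on_square
    {X : Type*} [Nonempty X]
    (star : ℝ → ℝ → ℝ) (M : X → X → ℝ)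
    -- `star` is a continuous t-norm on [0,1]:
    (hstar_mem : ∀ a b : ℝ, a ∈ Set.Icc (0:ℝ) 1 → b ∈ Set.Icc (0:ℝ) 1 →
      star a b ∈ Set.Icc (0:ℝ) 1)
    (hstar_cont : ContinuousOn (fun p : ℝ × ℝ => star p.1 p.2)
      (Set.Icc (0:ℝ) 1 ×ˢ Set.Icc (0:ℝ) 1))
    (hstar_comm : ∀ a b : ℝ, a ∈ Set.Icc (0:ℝ) 1 → b ∈ Set.Icc (0:ℝ) 1 →
      star a b = star b a)
    (hstar_assoc : ∀ a b c : ℝ, a ∈ Set.Icc (0:ℝ) 1 → b ∈ Set.Icc (0:ℝ) 1 →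
      c ∈ Set.Icc (0:ℝ) 1 → star (star a b) c = star a (star b c))
    (hstar_mono : ∀ a b c : ℝ, a ∈ Set.Icc (0:ℝ) 1 → b ∈ Set.Icc (0:ℝ) 1 →
      c ∈ Set.Icc (0:ℝ) 1 → a ≤ b → star a c ≤ star b c)
    (hstar_one : ∀ a : ℝ, a ∈ Set.Icc (0:ℝ) 1 → star a 1 = a)
    -- `M` is a stationary fuzzy metric:
    (hM_mem : ∀ x y : X, M x y ∈ Set.Ioc (0:ℝ) 1)
    (hM_eq_one : ∀ x y : X, M x y = 1 ↔ x = y)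
    (hM_symm : ∀ x y : X, M x y = M y x)
    (hM_tri : ∀ x y z : X, star (M x y) (M y z) ≤ M x z)
    -- `M̂` on `X²`:
    (Mhat : X × X → X × X → ℝ)
    (hMhat : ∀ p q : X × X, Mhat p q = min (M p.1 q.1) (M p.2 q.2)) :
    ∀ ε : ℝ, ε > 0 → ∃ δ ∈ Set.Ioo (0:ℝ) 1,
      ∀ p q : X × X, Mhat p q > 1 - δ → |M p.1 p.2 - M q.1 q.2| < ε := by
  intro ε hε
  obtain ⟨δ, hδ, h⟩ :=
    exists_forall_sub_lt_of_continuousOn_of_right_one star hstar_cont hstar_one (half_pos hε)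
  have hM : ∀ x y : X, M x y ∈ Set.Icc (0:ℝ) 1 := fun x y => Set.Ioc_subset_Icc_self (hM_mem x y)
  have key : ∀ x z x' z' : X, 1 - δ < M x x' → 1 - δ < M z z' →
      M x' z' - ε < M x z := by
    intro x z x' z' hx hz
    rw [hM_symm z z'] at hz
    have h₁ := h _ (hM x' z) _ (hM x x') hx
    have h₂ := h _ (hM x' z') _ (hM z' z) hz
    rw [hstar_comm _ _ (hM x' z) (hM x x')] at h₁
    linarith [hM_tri x x' z, hM_tri x' z' z]
  refine ⟨δ, hδ, fun p q hpq => ?_⟩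
  rw [hMhat] at hpq
  obtain ⟨hx, hz⟩ := lt_min_iff.1 hpq
  have h₁ := key p.1 p.2 q.1 q.2 hx hz
  have h₂ := key q.1 q.2 p.1 p.2 (hM_symm p.1 q.1 ▸ hx) (hM_symm p.2 q.2 ▸ hz)
  exact abs_lt.2 ⟨by linarith, by linarith⟩
end
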